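/- Let E be a group, G a normal subgroup of E, and δ ∈ E with δ² ∈ Z(G), the center of G; let σ be the involutive automorphism of Z(G) given by conjugation by δ. Define (1+σ)Z(G) = {z · σ(z) : z ∈ Z(G)}, a subgroup of the fixed-point subgroup Z(G)^σ = {z ∈ Z(G) : σ(z) = z}. Then δ² ∈ Z(G)^σ, and for every z₁ ∈ Z(G) and g ∈ G the elements δ² and (z₁ · g δ g⁻¹)² lie in the same coset of (1+σ)Z(G) in Z(G)^σ. Hence the class of δ² in Z(G)^σ/(1+σ)Z(G) is unchanged when δ is replaced by z₁ g δ g⁻¹. -/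

import Mathlib

/-!
Statement 8: Let `G` be a normal subgroup of `E` and `δ ∈ E` with
`δ² ∈ Z(G) = G ⊓ centralizer G`; let `σ z = δ z δ⁻¹` be the induced involution of
`Z(G)`, and `(1+σ)Z(G) = {z * σ z : z ∈ Z(G)}`. Then: `(1+σ)Z(G)` consists of
`σ`-fixed elements of `Z(G)`; `δ²` is `σ`-fixed; and for every `z₁ ∈ Z(G)` and
`g ∈ G`, the elements `δ²` and `(z₁ * (g δ g⁻¹))²` lie in the same coset of
`(1+σ)Z(G)`, i.e. `(z₁ * (g δ g⁻¹))² = (w * σ w) * δ²` for some `w ∈ Z(G)`.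
-/

section

variable {E : Type*} [Group E] {G : Subgroup E}

theorem commute_of_mem_inf_centralizer {z g : E}
    (hz : z ∈ G ⊓ Subgroup.centralizer (G : Set E)) (hg : g ∈ G) : Commute z g :=
  (Subgroup.mem_centralizer_iff.mp hz.2 g hg).symm

theorem sq_mul_conj_of_commute {z g δ : E} (hz : Commute z g)
    (hσ : Commute (δ * z * δ⁻¹) g) (hδ : Commute (δ ^ 2) g) :
    (z * (g * δ * g⁻¹)) ^ 2 = z * (δ * z * δ⁻¹) * δ ^ 2 :=
  calc (z * (g * δ * g⁻¹)) ^ 2 = z * (g * δ * (g⁻¹ * (z * g)) * δ * g⁻¹) := by rw [pow_two]; group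
    _ = z * (g * (δ * z * δ⁻¹)) * δ ^ 2 * g⁻¹ := by rw [hz.eq]; group
    _ = z * (δ * z * δ⁻¹) * (g * δ ^ 2) * g⁻¹ := by rw [← hσ.eq]; group
    _ = z * (δ * z * δ⁻¹) * δ ^ 2 := by rw [← hδ.eq]; group

end

theorem second_invariant_well_defined (E : Type*) [Group E]
    (G : Subgroup E) [G.Normal] (δ : E)
    (hδ : δ ^ 2 ∈ G ⊓ Subgroup.centralizer (G : Set E)) :
    (δ * δ ^ 2 * δ⁻¹ = δ ^ 2) ∧
    (∀ z ∈ G ⊓ Subgroup.centralizer (G : Set E),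
      z * (δ * z * δ⁻¹) ∈ G ⊓ Subgroup.centralizer (G : Set E) ∧
      δ * (z * (δ * z * δ⁻¹)) * δ⁻¹ = z * (δ * z * δ⁻¹)) ∧
    (∀ z₁ ∈ G ⊓ Subgroup.centralizer (G : Set E), ∀ g ∈ G,
      ∃ w ∈ G ⊓ Subgroup.centralizer (G : Set E),
        (z₁ * (g * δ * g⁻¹)) ^ 2 = (w * (δ * w * δ⁻¹)) * δ ^ 2) := by
  have hconj : ∀ z ∈ G ⊓ Subgroup.centralizer (G : Set E),
      δ * z * δ⁻¹ ∈ G ⊓ Subgroup.centralizer (G : Set E) :=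
    fun z hz => Subgroup.Normal.conj_mem inferInstance z hz δ
  refine ⟨by group, fun z hz => ⟨mul_mem hz (hconj z hz), ?_⟩, fun z hz g hg => ⟨z, hz, ?_⟩⟩
  · calc δ * (z * (δ * z * δ⁻¹)) * δ⁻¹
        = (δ * z * δ⁻¹) * (δ ^ 2 * z * (δ ^ 2)⁻¹) := by group
      _ = (δ * z * δ⁻¹) * z := by
        rw [(commute_of_mem_inf_centralizer hδ hz.1).eq, mul_inv_cancel_right]
      _ = z * (δ * z * δ⁻¹) := (commute_of_mem_inf_centralizer (hconj z hz) hz.1).eq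
  · exact sq_mul_conj_of_commute (commute_of_mem_inf_centralizer hz hg)
      (commute_of_mem_inf_centralizer (hconj z hz) hg) (commute_of_mem_inf_centralizer hδ hg)
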